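/- Let B be the Minkowski bilinear form on ℝ^{n+1} and let F be a linear subspace of ℝ^{n+1} with 2 ≤ dim F ≤ n on which B restricts nondegenerately and which contains a point of the hyperboloid ℍⁿ = {w : B(w,w) = 1, w₀ > 0}. Let f be the B-orthogonal projection onto F and let x ∈ ℍⁿ. Then B(f(x), f(x)) > 0, the first coordinate of f(x) is positive, and the point p = f(x)/√(B(f(x), f(x))) lies in F ∩ ℍⁿ and is the unique point of F ∩ ℍⁿ at minimal hyperbolic distance from x; equivalently, for every z ∈ F with B(z,z) = 1 and z₀ > 0 one has B(x, p) ≤ B(x, z), with equality if and only if z = p. -/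

import Mathlib

/-- The Minkowski bilinear form on `ℝ^{n+1}`. -/
def minkowskiForm (n : ℕ) (x y : Fin (n + 1) → ℝ) : ℝ :=
  x 0 * y 0 - ∑ i : Fin n, x i.succ * y i.succ

/-- The hyperboloid model `ℍⁿ = {w : B(w,w) = 1, w₀ > 0}`. -/
def hyperboloid (n : ℕ) : Set (Fin (n + 1) → ℝ) :=
  {w | minkowskiForm n w w = 1 ∧ 0 < w 0}

theorem minkowskiForm_comm {n : ℕ} (x y : Fin (n + 1) → ℝ) :
    minkowskiForm n x y = minkowskiForm n y x := by
  simp only [minkowskiForm, mul_comm]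

theorem minkowskiForm_sub_left {n : ℕ} (x y z : Fin (n + 1) → ℝ) :
    minkowskiForm n (x - y) z = minkowskiForm n x z - minkowskiForm n y z := by
  simp only [minkowskiForm, Pi.sub_apply, sub_mul, Finset.sum_sub_distrib]
  ring

theorem minkowskiForm_smul_left {n : ℕ} (c : ℝ) (x y : Fin (n + 1) → ℝ) :
    minkowskiForm n (c • x) y = c * minkowskiForm n x y := by
  simp only [minkowskiForm, Pi.smul_apply, smul_eq_mul, mul_assoc, mul_sub, Finset.mul_sum]

theorem minkowskiForm_sub_right {n : ℕ} (x y z : Fin (n + 1) → ℝ) :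
    minkowskiForm n x (y - z) = minkowskiForm n x y - minkowskiForm n x z := by
  rw [minkowskiForm_comm, minkowskiForm_sub_left, minkowskiForm_comm y, minkowskiForm_comm z]

theorem minkowskiForm_smul_right {n : ℕ} (c : ℝ) (x y : Fin (n + 1) → ℝ) :
    minkowskiForm n x (c • y) = c * minkowskiForm n x y := by
  rw [minkowskiForm_comm, minkowskiForm_smul_left, minkowskiForm_comm y]

theorem minkowskiForm_self {n : ℕ} (x : Fin (n + 1) → ℝ) :
    minkowskiForm n x x = x 0 ^ 2 - ∑ i : Fin n, x i.succ ^ 2 := by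
  simp only [minkowskiForm, sq]

/-- The orthogonal complement of a timelike vector is negative definite. -/
theorem minkowskiForm_self_neg_of_orthogonal {n : ℕ} {r w : Fin (n + 1) → ℝ}
    (hw : 0 < minkowskiForm n w w) (hrw : minkowskiForm n r w = 0) (hr : r ≠ 0) :
    minkowskiForm n r r < 0 := by
  have hcs := Finset.sum_mul_sq_le_sq_mul_sq Finset.univ
    (fun i : Fin n => r i.succ) (fun i => w i.succ)
  rw [minkowskiForm, sub_eq_zero] at hrw
  rw [minkowskiForm_self] at hw ⊢
  rw [← hrw] at hcs
  have hR : 0 ≤ ∑ i : Fin n, r i.succ ^ 2 := Finset.sum_nonneg fun i _ => sq_nonneg _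
  have hW : 0 ≤ ∑ i : Fin n, w i.succ ^ 2 := Finset.sum_nonneg fun i _ => sq_nonneg _
  have hw0 : 0 < w 0 ^ 2 := by linarith
  rcases hR.eq_or_lt with hR0 | hRpos
  · refine absurd (funext fun i => ?_) hr
    refine Fin.cases ?_ (fun j => ?_) i
    · rw [← hR0, zero_mul, mul_pow] at hcs
      have : r 0 ^ 2 ≤ 0 := nonpos_of_mul_nonpos_left hcs hw0
      exact pow_eq_zero_iff two_ne_zero |>.1 (le_antisymm this (sq_nonneg _))
    · have := (Finset.sum_eq_zero_iff_of_nonneg fun i _ => sq_nonneg _).1 hR0.symm j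
        (Finset.mem_univ j)
      exact pow_eq_zero_iff two_ne_zero |>.1 this
  · have : r 0 ^ 2 * w 0 ^ 2 < (∑ i : Fin n, r i.succ ^ 2) * w 0 ^ 2 := by
      rw [← mul_pow]
      exact hcs.trans_lt (mul_lt_mul_of_pos_left (by linarith) hRpos)
    linarith [lt_of_mul_lt_mul_right this hw0.le]

/-- Two future-directed timelike vectors have positive Minkowski product. -/
theorem minkowskiForm_pos {n : ℕ} {u w : Fin (n + 1) → ℝ}
    (hu : 0 < minkowskiForm n u u) (hw : 0 < minkowskiForm n w w)
    (hu0 : 0 < u 0) (hw0 : 0 < w 0) : 0 < minkowskiForm n u w := by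
  have hcs := Finset.sum_mul_sq_le_sq_mul_sq Finset.univ
    (fun i : Fin n => u i.succ) (fun i => w i.succ)
  rw [minkowskiForm_self, sub_pos] at hu hw
  have hU : 0 ≤ ∑ i : Fin n, u i.succ ^ 2 := Finset.sum_nonneg fun i _ => sq_nonneg _
  have hW : 0 ≤ ∑ i : Fin n, w i.succ ^ 2 := Finset.sum_nonneg fun i _ => sq_nonneg _
  rw [minkowskiForm, sub_pos]
  refine lt_of_pow_lt_pow_left₀ 2 (mul_pos hu0 hw0).le (hcs.trans_lt ?_)
  rw [mul_pow]
  exact mul_lt_mul'' hu hw hU hW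

theorem pos_of_minkowskiForm_pos {n : ℕ} {u w : Fin (n + 1) → ℝ}
    (hu : 0 < minkowskiForm n u u) (hw : 0 < minkowskiForm n w w)
    (hw0 : 0 < w 0) (huw : 0 < minkowskiForm n u w) : 0 < u 0 := by
  by_contra! h
  have hne : u 0 ≠ 0 := by
    intro h0
    rw [minkowskiForm_self, h0] at hu
    have : 0 ≤ ∑ i : Fin n, u i.succ ^ 2 := Finset.sum_nonneg fun i _ => sq_nonneg _
    linarith
  have hneg : 0 < ((-1 : ℝ) • u) 0 := by
    simpa using lt_of_le_of_ne h hne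
  have := minkowskiForm_pos (u := (-1 : ℝ) • u)
    (by rw [minkowskiForm_smul_left, minkowskiForm_smul_right]; linarith) hw hneg hw0
  rw [minkowskiForm_smul_left] at this
  linarith

/-- The reversed Cauchy–Schwarz inequality on the hyperboloid, in its strict form. -/
theorem one_lt_minkowskiForm {n : ℕ} {u w : Fin (n + 1) → ℝ}
    (hu : u ∈ hyperboloid n) (hw : w ∈ hyperboloid n) (hne : u ≠ w) :
    1 < minkowskiForm n u w := by
  obtain ⟨hu1, hu0⟩ := hu
  obtain ⟨hw1, hw0⟩ := hw
  have hpos : 0 < minkowskiForm n u w :=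
    minkowskiForm_pos (by linarith) (by linarith) hu0 hw0
  set c := minkowskiForm n u w with hc
  by_cases hr : u - c • w = 0
  · have huc : u = c • w := sub_eq_zero.1 hr
    have hcc : c * c = 1 := by
      rw [huc, minkowskiForm_smul_left, minkowskiForm_smul_right, hw1, mul_one] at hu1
      exact hu1
    have hc1 : c = 1 := by nlinarith
    rw [hc1, one_smul] at huc
    exact absurd huc hne
  · have horth : minkowskiForm n (u - c • w) w = 0 := by
      rw [minkowskiForm_sub_left, minkowskiForm_smul_left, hw1, ← hc]
      ring
    have := minkowskiForm_self_neg_of_orthogonal (by linarith) horth hr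
    rw [minkowskiForm_sub_right, minkowskiForm_smul_right, horth, minkowskiForm_sub_left,
      minkowskiForm_smul_left, minkowskiForm_comm w, hu1, ← hc] at this
    nlinarith

/-- **Metrical projection onto a hyperbolic subspace `F ∩ ℍⁿ`.**
For `x ∈ ℍⁿ` and `f` the `B`-orthogonal projection onto `F` (a subspace
on which `B` restricts nondegenerately and which meets `ℍⁿ`), one has
`B(f(x), f(x)) > 0`, `(f x)₀ > 0`, and `p = f(x)/√(B(f(x),f(x)))` is the
unique point of `F ∩ ℍⁿ` at minimal hyperbolic distance from `x`. -/
theorem metrical_projection_hyperbolic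
    {n : ℕ} (F : Submodule ℝ (Fin (n + 1) → ℝ))
    (hFnd : ∀ v ∈ F, (∀ w ∈ F, minkowskiForm n v w = 0) → v = 0)
    (hFH : ∃ w ∈ F, w ∈ hyperboloid n)
    (f : (Fin (n + 1) → ℝ) →ₗ[ℝ] (Fin (n + 1) → ℝ))
    (hfF : ∀ x, f x ∈ F)
    (hf : ∀ x, ∀ w ∈ F, minkowskiForm n (x - f x) w = 0)
    (x : Fin (n + 1) → ℝ) (hx : x ∈ hyperboloid n) :
    0 < minkowskiForm n (f x) (f x) ∧ 0 < (f x) 0 ∧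
      ((Real.sqrt (minkowskiForm n (f x) (f x)))⁻¹ • f x ∈ F ∧
        (Real.sqrt (minkowskiForm n (f x) (f x)))⁻¹ • f x ∈ hyperboloid n) ∧
      ∀ z ∈ F, z ∈ hyperboloid n →
        (minkowskiForm n x ((Real.sqrt (minkowskiForm n (f x) (f x)))⁻¹ • f x)
            ≤ minkowskiForm n x z ∧
          (minkowskiForm n x
              ((Real.sqrt (minkowskiForm n (f x) (f x)))⁻¹ • f x)
              = minkowskiForm n x z ↔
            z = (Real.sqrt (minkowskiForm n (f x) (f x)))⁻¹ • f x)) := by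
  obtain ⟨w, hwF, hw1, hw0⟩ := hFH
  have hw : 0 < minkowskiForm n w w := by linarith
  obtain ⟨hx1, hx0⟩ := hx
  have hfx : ∀ z ∈ F, minkowskiForm n x z = minkowskiForm n (f x) z := fun z hz => by
    have := hf x z hz
    rwa [minkowskiForm_sub_left, sub_eq_zero] at this
  have hq : 0 < minkowskiForm n (f x) (f x) := by
    have hself : minkowskiForm n (x - f x) (x - f x) = 1 - minkowskiForm n (f x) (f x) := by
      rw [minkowskiForm_sub_right, hf x _ (hfF x), minkowskiForm_sub_left, hx1,
        minkowskiForm_comm (f x) x, hfx _ (hfF x), sub_zero]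
    by_cases hr : x - f x = 0
    · rw [← sub_eq_zero.1 hr, hx1]
      exact one_pos
    · linarith [minkowskiForm_self_neg_of_orthogonal hw (hf x w hwF) hr]
  have hq0 : 0 < f x 0 := by
    refine pos_of_minkowskiForm_pos hq hw hw0 ?_
    rw [← hfx w hwF]
    exact minkowskiForm_pos (by linarith) hw hx0 hw0
  set s := Real.sqrt (minkowskiForm n (f x) (f x)) with hs
  have hspos : 0 < s := Real.sqrt_pos.2 hq
  have hss : minkowskiForm n (f x) (f x) = s * s := (Real.mul_self_sqrt hq.le).symm
  have hpF : s⁻¹ • f x ∈ F := F.smul_mem _ (hfF x)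
  have hpH : s⁻¹ • f x ∈ hyperboloid n := by
    refine ⟨?_, mul_pos (inv_pos.2 hspos) hq0⟩
    rw [minkowskiForm_smul_left, minkowskiForm_smul_right, hss]
    field_simp
  have hxz : ∀ z ∈ F, minkowskiForm n x z = s * minkowskiForm n (s⁻¹ • f x) z := fun z hz => by
    rw [hfx z hz, minkowskiForm_smul_left, mul_inv_cancel_left₀ hspos.ne']
  refine ⟨hq, hq0, ⟨hpF, hpH⟩, fun z hzF hzH => ?_⟩
  by_cases hz : z = s⁻¹ • f x
  · simp [hz]
  · have hlt : minkowskiForm n x (s⁻¹ • f x) < minkowskiForm n x z := by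
      rw [hxz _ hpF, hxz z hzF, hpH.1]
      exact mul_lt_mul_of_pos_left (one_lt_minkowskiForm hpH hzH (Ne.symm hz)) hspos
    exact ⟨hlt.le, iff_of_false hlt.ne hz⟩
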